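/- arXiv:2110.15781 — 2 statements merged into one kernel-verified Lean document; each statement's English description precedes it below -/
import Mathlib

section
/- (Proposition 3) For every n ∈ ℕ with n ≥ 5, there is a reciprocal recommendation setting with n users (i.e., a choice of symmetric preferences μ and exposure weights v) such that: for every θ ∈ Θ and every maximizer u^θ of W_θ over 𝒰, there exists β > 0 such that for every u^{eq,β} maximizing F^eq_β over 𝒰, one has u^θ_i > u^{eq,β}_i for every i ∈ {1,…,n}; moreover, for every selection β ↦ u^{eq,β} of maximizers of F^eq_β over 𝒰, lim_{β→∞} ∑_{i=1}^n u^{eq,β}_i = 0. -/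
/-- `ψ(x, α)`, extended-real valued, with the conventions `ψ(0,α) = 0` for `α > 0`
and `ψ(0,α) = -∞` for `α ≤ 0`. -/
noncomputable def psi (x α : ℝ) : EReal :=
  if 0 < α then ((x ^ α : ℝ) : EReal)
  else if x = 0 then (⊥ : EReal)
  else if α = 0 then ((Real.log x : ℝ) : EReal)
  else ((-(x ^ α) : ℝ) : EReal)

/-- A `p × p` doubly stochastic matrix. -/
def DoublyStochastic {p : ℕ} (M : Fin p → Fin p → ℝ) : Prop :=
  (∀ j k, 0 ≤ M j k) ∧ (∀ j, ∑ k, M j k = 1) ∧ (∀ k, ∑ j, M j k = 1)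

/-- The set `𝒫` of ranking tensors: one doubly stochastic matrix per user.
`P i j k` is the probability that item `j` is shown to user `i` at rank `k`. -/
def RankingTensors (m p : ℕ) : Set (Fin m → Fin p → Fin p → ℝ) :=
  {P | ∀ i, DoublyStochastic (P i)}

/-- User-side utility `u_i(P) = ∑_j μ_{ij} ∑_k P_{ijk} v_k`. -/
def userUtil {m p : ℕ} (μ : Fin m → Fin p → ℝ) (v : Fin p → ℝ)
    (P : Fin m → Fin p → Fin p → ℝ) (i : Fin m) : ℝ :=
  ∑ j, μ i j * ∑ k, P i j k * v k

/-- Item-side utility (exposure) `u_j(P) = ∑_i ∑_k P_{ijk} v_k`. -/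
def itemUtil {m p : ℕ} (v : Fin p → ℝ)
    (P : Fin m → Fin p → Fin p → ℝ) (j : Fin p) : ℝ :=
  ∑ i, ∑ k, P i j k * v k

/-- Two-sided utility in reciprocal recommendation:
`u_i(P) = ∑_j μ_{ij} ∑_k (P_{ijk} + P_{jik}) v_k`. -/
def recUtil {n : ℕ} (μ : Fin n → Fin n → ℝ) (v : Fin n → ℝ)
    (P : Fin n → Fin n → Fin n → ℝ) (i : Fin n) : ℝ :=
  ∑ j, μ i j * ∑ k, (P i j k + P j i k) * v k

/-- Welfare function in the reciprocal setting (`𝒩 = ℐ`):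
`W_θ(u) = (1-λ) ∑_i ψ(u_i, α₁) + λ ∑_i ψ(u_i, α₂)`. -/
noncomputable def recWelfare {n : ℕ} (lam a1 a2 : ℝ) (u : Fin n → ℝ) : EReal :=
  ((1 - lam : ℝ) : EReal) * ∑ i, psi (u i) a1 + ((lam : ℝ) : EReal) * ∑ i, psi (u i) a2

/-- Equality-of-utility objective `F^eq_β(u) = ∑_i u_i - β √(D(u))`,
`D(u) = (1/n) ∑_i (u_i - (1/n) ∑_{i'} u_{i'})²`. -/
noncomputable def Feq {n : ℕ} (β : ℝ) (u : Fin n → ℝ) : ℝ :=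
  (∑ i, u i) - β * Real.sqrt ((1 / (n : ℝ)) * ∑ i, (u i - (1 / (n : ℝ)) * ∑ i', u i') ^ 2)

lemma doublyStochastic_perm {p : ℕ} (σ : Equiv.Perm (Fin p)) :
    DoublyStochastic (fun j k => if j = σ k then (1 : ℝ) else 0) := by
  refine ⟨fun j k => by positivity, fun j => ?_, fun k => by simp⟩
  simp [← Equiv.symm_apply_eq, Finset.sum_ite_eq]

lemma psi_of_pos {x : ℝ} (hx : 0 < x) (α : ℝ) : ∃ r : ℝ, psi x α = r := by
  unfold psi
  split_ifs with h1 h2 h3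
  · exact ⟨_, rfl⟩
  · exact absurd h2 hx.ne'
  · exact ⟨_, rfl⟩
  · exact ⟨_, rfl⟩

lemma sum_coe_ereal {ι : Type*} (s : Finset ι) (f : ι → ℝ) :
    ∑ i ∈ s, (f i : EReal) = ((∑ i ∈ s, f i : ℝ) : EReal) := by
  classical
  induction s using Finset.induction_on with
  | empty => simp
  | insert a s ha ih => rw [Finset.sum_insert ha, Finset.sum_insert ha, ih, EReal.coe_add]

lemma sum_psi_of_pos {n : ℕ} {w : Fin n → ℝ} (hw : ∀ j, 0 < w j) (α : ℝ) :
    ∃ r : ℝ, ∑ j, psi (w j) α = r := by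
  choose f hf using fun j => psi_of_pos (hw j) α
  exact ⟨∑ j, f j, by simp only [hf, sum_coe_ereal]⟩

/-- Raising a vanishing coordinate strictly increases the sum of the `ψ(·, α)`. -/
lemma sum_psi_lt_sum_psi {n : ℕ} {u w : Fin n → ℝ} (hu : ∀ j, 0 ≤ u j) (huw : ∀ j, u j ≤ w j)
    (hw : ∀ j, 0 < w j) {i : Fin n} (hi : u i = 0) (α : ℝ) :
    ∑ j, psi (u j) α < ∑ j, psi (w j) α := by
  by_cases hα : 0 < α
  · simp only [psi, hα, if_true, sum_coe_ereal, EReal.coe_lt_coe_iff]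
    refine Finset.sum_lt_sum (fun j _ => Real.rpow_le_rpow (hu j) (huw j) hα.le)
      ⟨i, Finset.mem_univ i, Real.rpow_lt_rpow (hu i) (hi ▸ hw i) hα⟩
  · obtain ⟨r, hr⟩ := sum_psi_of_pos hw α
    have hbot : psi (u i) α = ⊥ := by simp [psi, hα, hi]
    rw [hr, ← Finset.add_sum_erase _ _ (Finset.mem_univ i), hbot, EReal.bot_add]
    exact EReal.bot_lt_coe r

lemma recWelfare_lt_recWelfare {n : ℕ} {lam : ℝ} (h0 : 0 < lam) (h1 : lam < 1) (a1 a2 : ℝ)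
    {u w : Fin n → ℝ} (hu : ∀ j, 0 ≤ u j) (huw : ∀ j, u j ≤ w j)
    (hw : ∀ j, 0 < w j) {i : Fin n} (hi : u i = 0) :
    recWelfare lam a1 a2 u < recWelfare lam a1 a2 w := by
  have A := sum_psi_lt_sum_psi hu huw hw hi a1
  have B := sum_psi_lt_sum_psi hu huw hw hi a2
  unfold recWelfare
  obtain ⟨r, hr⟩ := sum_psi_of_pos hw a1
  obtain ⟨s, hs⟩ := sum_psi_of_pos hw a2
  rw [hr] at A ⊢
  rw [hs] at B ⊢
  have h1' : 0 < 1 - lam := by linarith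
  generalize ∑ j, psi (u j) a1 = x at A ⊢
  generalize ∑ j, psi (u j) a2 = y at B ⊢
  have hb : ⊥ < ((1 - lam : ℝ) : EReal) * r + (lam : EReal) * s := by
    rw [← EReal.coe_mul, ← EReal.coe_mul, ← EReal.coe_add]
    exact EReal.bot_lt_coe _
  induction x with
  | bot => rwa [EReal.coe_mul_bot_of_pos h1', EReal.bot_add]
  | top => exact absurd A (by simp)
  | coe x =>
    induction y with
    | bot => rwa [EReal.coe_mul_bot_of_pos h0, EReal.add_bot]
    | top => exact absurd B (by simp)
    | coe y =>
      rw [EReal.coe_lt_coe_iff] at A B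
      simp only [← EReal.coe_mul, ← EReal.coe_add, EReal.coe_lt_coe_iff]
      exact add_lt_add (mul_lt_mul_of_pos_left A h1') (mul_lt_mul_of_pos_left B h0)

/-- Preferences of a star: user `0` and every other user like each other. -/
def starPref (m : ℕ) (i j : Fin (m + 1)) : ℝ :=
  if i = 0 then (if j = 0 then 0 else 1) else (if j = 0 then 1 else 0)

/-- Exposure is given by the first rank only. -/
def topWeight (m : ℕ) (k : Fin (m + 1)) : ℝ := if k = 0 then 1 else 0

lemma recUtil_star_succ {m : ℕ} (P : Fin (m + 1) → Fin (m + 1) → Fin (m + 1) → ℝ) (j : Fin m) :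
    recUtil (starPref m) (topWeight m) P j.succ = P j.succ 0 0 + P 0 j.succ 0 := by
  simp [recUtil, starPref, topWeight]

lemma recUtil_star_zero {m : ℕ} (P : Fin (m + 1) → Fin (m + 1) → Fin (m + 1) → ℝ) :
    recUtil (starPref m) (topWeight m) P 0
      = ∑ j : Fin m, recUtil (starPref m) (topWeight m) P j.succ := by
  simp only [recUtil_star_succ]
  simp [recUtil, starPref, topWeight, Fin.sum_univ_succ, add_comm]

lemma recUtil_star_nonneg {m : ℕ} {P : Fin (m + 1) → Fin (m + 1) → Fin (m + 1) → ℝ}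
    (hP : P ∈ RankingTensors (m + 1) (m + 1)) (i : Fin (m + 1)) :
    0 ≤ recUtil (starPref m) (topWeight m) P i := by
  have hs (j : Fin m) : 0 ≤ recUtil (starPref m) (topWeight m) P j.succ := by
    rw [recUtil_star_succ]
    exact add_nonneg ((hP _).1 _ _) ((hP _).1 _ _)
  refine Fin.cases ?_ hs i
  rw [recUtil_star_zero]
  exact Finset.sum_nonneg fun j _ => hs j

lemma DoublyStochastic.le_one {p : ℕ} {M : Fin p → Fin p → ℝ} (hM : DoublyStochastic M)
    (j k : Fin p) : M j k ≤ 1 :=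
  hM.2.1 j ▸ Finset.single_le_sum (fun l _ => hM.1 j l) (Finset.mem_univ k)

/-- Welfare maximizers on the star give positive utility to everyone. -/
lemma recUtil_star_pos_of_welfare_max {m : ℕ} (hm : 0 < m) {lam a1 a2 : ℝ} (h0 : 0 < lam)
    (h1 : lam < 1) {P : Fin (m + 1) → Fin (m + 1) → Fin (m + 1) → ℝ}
    (hP : P ∈ RankingTensors (m + 1) (m + 1))
    (hmax : ∀ Q ∈ RankingTensors (m + 1) (m + 1),
      recWelfare lam a1 a2 (recUtil (starPref m) (topWeight m) Q)
        ≤ recWelfare lam a1 a2 (recUtil (starPref m) (topWeight m) P)) (i : Fin (m + 1)) :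
    0 < recUtil (starPref m) (topWeight m) P i := by
  have : NeZero m := ⟨hm.ne'⟩
  set Q : Fin (m + 1) → Fin (m + 1) → Fin (m + 1) → ℝ :=
    fun i => if i = 0 then P 0 else fun j k => if j = Equiv.refl _ k then 1 else 0 with hQdef
  have hQ : Q ∈ RankingTensors (m + 1) (m + 1) := by
    intro i
    by_cases hi : i = 0
    · simpa [hQdef, hi] using hP 0
    · simpa [hQdef, hi] using doublyStochastic_perm (Equiv.refl (Fin (m + 1)))
  have hQs (j : Fin m) : recUtil (starPref m) (topWeight m) Q j.succ = 1 + P 0 j.succ 0 := by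
    simp [recUtil_star_succ, hQdef]
  have hQspos (j : Fin m) : 0 < recUtil (starPref m) (topWeight m) Q j.succ := by
    have := (hP 0).1 j.succ 0
    rw [hQs]; linarith
  have hles (j : Fin m) : recUtil (starPref m) (topWeight m) P j.succ
      ≤ recUtil (starPref m) (topWeight m) Q j.succ := by
    have := (hP j.succ).le_one 0 0
    rw [hQs, recUtil_star_succ]; linarith
  have hQpos (j) : 0 < recUtil (starPref m) (topWeight m) Q j := by
    refine Fin.cases ?_ hQspos j
    rw [recUtil_star_zero]
    exact Finset.sum_pos (fun j _ => hQspos j) Finset.univ_nonempty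
  have hle (j) : recUtil (starPref m) (topWeight m) P j
      ≤ recUtil (starPref m) (topWeight m) Q j := by
    refine Fin.cases ?_ hles j
    rw [recUtil_star_zero, recUtil_star_zero]
    exact Finset.sum_le_sum fun j _ => hles j
  refine (recUtil_star_nonneg hP i).lt_of_ne' fun hi => ?_
  exact absurd (hmax Q hQ)
    (recWelfare_lt_recWelfare h0 h1 a1 a2 (recUtil_star_nonneg hP) hle hQpos hi).not_ge

lemma exists_recUtil_star_eq_zero (m : ℕ) :
    ∃ Q ∈ RankingTensors (m + 1) (m + 1), recUtil (starPref m) (topWeight m) Q = 0 := by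
  refine ⟨fun i j k => if j = Equiv.swap 0 i k then 1 else 0,
    fun i => doublyStochastic_perm _, ?_⟩
  have hs (j : Fin m) : recUtil (starPref m) (topWeight m)
      (fun i j k => if j = Equiv.swap 0 i k then 1 else 0) j.succ = 0 := by
    simp [recUtil_star_succ, (Fin.succ_ne_zero j).symm]
  funext i
  refine Fin.cases ?_ hs i
  rw [recUtil_star_zero]
  exact Finset.sum_eq_zero fun j _ => hs j

/-- On the star, a large enough equality penalty forces all utilities to vanish. -/
lemma recUtil_star_eq_zero_of_Feq_max {m : ℕ} (hm : 2 ≤ m) {β : ℝ} (hβ : 2 * (m + 1) ^ 2 < β)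
    {P : Fin (m + 1) → Fin (m + 1) → Fin (m + 1) → ℝ}
    (hP : P ∈ RankingTensors (m + 1) (m + 1))
    (hmax : ∀ Q ∈ RankingTensors (m + 1) (m + 1),
      Feq β (recUtil (starPref m) (topWeight m) Q)
        ≤ Feq β (recUtil (starPref m) (topWeight m) P)) (i : Fin (m + 1)) :
    recUtil (starPref m) (topWeight m) P i = 0 := by
  obtain ⟨Q, hQ, hQ0⟩ := exists_recUtil_star_eq_zero m
  have hF := hmax Q hQ
  have hm' : (2 : ℝ) ≤ m := by exact_mod_cast hm
  have hcenter := recUtil_star_zero P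
  have hnn := recUtil_star_nonneg hP
  rw [hQ0] at hF
  generalize recUtil (starPref m) (topWeight m) P = u at *
  have hsum : ∑ j, u j = 2 * u 0 := by
    rw [Fin.sum_univ_succ, ← hcenter]; ring
  have hle : u i ≤ ∑ j, u j := Finset.single_le_sum (fun j _ => hnn j) (Finset.mem_univ i)
  have hsqrt : u 0 / (m + 1) ^ 2 ≤ Real.sqrt ((1 / ((m + 1 : ℕ) : ℝ)) *
      ∑ j, (u j - (1 / ((m + 1 : ℕ) : ℝ)) * ∑ j', u j') ^ 2) := by
    apply Real.le_sqrt_of_sq_le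
    have h1 : (u 0 - (1 / ((m + 1 : ℕ) : ℝ)) * ∑ j', u j') ^ 2
        ≤ ∑ j, (u j - (1 / ((m + 1 : ℕ) : ℝ)) * ∑ j', u j') ^ 2 :=
      Finset.single_le_sum (f := fun j => (u j - (1 / ((m + 1 : ℕ) : ℝ)) * ∑ j', u j') ^ 2)
        (fun j _ => sq_nonneg _) (Finset.mem_univ 0)
    refine le_trans ?_ (mul_le_mul_of_nonneg_left h1 (by positivity))
    rw [hsum]
    push_cast
    have h2 : 1 / ((m : ℝ) + 1) * (u 0 - 1 / ((m : ℝ) + 1) * (2 * u 0)) ^ 2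
        = (u 0 / (m + 1) ^ 2) ^ 2 * ((m - 1) ^ 2 * (m + 1)) := by
      field_simp
      ring
    rw [h2]
    refine le_mul_of_one_le_right (sq_nonneg _) ?_
    nlinarith
  have hF0 : Feq β (0 : Fin (m + 1) → ℝ) = 0 := by simp [Feq]
  rw [hF0, Feq, hsum] at hF
  rw [hsum] at hsqrt
  have hβ0 : 0 < β := lt_trans (by positivity) hβ
  have h3 := mul_le_mul_of_nonneg_left hsqrt hβ0.le
  have h4 : β * (u 0 / (m + 1) ^ 2) ≤ 2 * u 0 := by linarith
  rw [← mul_div_assoc, div_le_iff₀ (by positivity)] at h4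
  have h5 : u 0 = 0 := by
    refine le_antisymm (not_lt.1 fun hpos => ?_) (hnn 0)
    nlinarith
  rw [hsum, h5, mul_zero] at hle
  exact le_antisymm hle (hnn i)

/-- Proposition 3: there is a reciprocal recommendation task with
`n ≥ 5` users on which, compared to any welfare maximizer, maximizing the
equality-of-utility objective strictly decreases the utility of *every* user for
some `β > 0`, and the total utility of any selection of maximizers tends to `0`
as `β → ∞`. -/
theorem equality_of_utility_inefficient (n : ℕ) (hn : 5 ≤ n) :
    ∃ (μ : Fin n → Fin n → ℝ) (v : Fin n → ℝ),
      (∀ i j, 0 ≤ μ i j) ∧ (∀ i j, μ i j = μ j i) ∧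
      (∀ k, 0 ≤ v k) ∧ (∀ k l : Fin n, k ≤ l → v l ≤ v k) ∧
      ∀ lam a1 a2 : ℝ, 0 < lam → lam < 1 → a1 < 1 → a2 < 1 →
      ∀ Pθ ∈ RankingTensors n n,
        (∀ P ∈ RankingTensors n n,
          recWelfare lam a1 a2 (recUtil μ v P) ≤ recWelfare lam a1 a2 (recUtil μ v Pθ)) →
        ((∃ β : ℝ, 0 < β ∧
            ∀ Pe ∈ RankingTensors n n,
              (∀ P ∈ RankingTensors n n,
                Feq β (recUtil μ v P) ≤ Feq β (recUtil μ v Pe)) →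
              ∀ i, recUtil μ v Pe i < recUtil μ v Pθ i) ∧
          (∀ sel : ℝ → (Fin n → Fin n → Fin n → ℝ),
            (∀ β : ℝ, 0 < β →
              sel β ∈ RankingTensors n n ∧
              ∀ P ∈ RankingTensors n n,
                Feq β (recUtil μ v P) ≤ Feq β (recUtil μ v (sel β))) →
            Filter.Tendsto (fun β => ∑ i, recUtil μ v (sel β) i)
              Filter.atTop (nhds (0 : ℝ)))) := by
  obtain ⟨m, rfl⟩ : ∃ m, n = m + 1 := ⟨n - 1, by omega⟩
  refine ⟨starPref m, topWeight m, fun i j => ?_, fun i j => ?_, fun k => ?_, fun k l hkl => ?_, ?_⟩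
  · unfold starPref; split_ifs <;> norm_num
  · unfold starPref; split_ifs <;> rfl
  · unfold topWeight; split_ifs <;> norm_num
  · unfold topWeight
    split_ifs with hl hk
    · rfl
    · exact absurd (Fin.le_zero_iff.1 (hl ▸ hkl)) hk
    · norm_num
    · rfl
  intro lam a1 a2 h0 h1 _ _ P hP hmax
  refine ⟨⟨2 * (m + 1) ^ 2 + 1, by positivity, fun Pe hPe hPemax i => ?_⟩, fun sel hsel => ?_⟩
  · rw [recUtil_star_eq_zero_of_Feq_max (by omega) (lt_add_one _) hPe hPemax i]
    exact recUtil_star_pos_of_welfare_max (by omega) h0 h1 hP hmax i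
  · refine tendsto_const_nhds.congr' ?_
    filter_upwards [Filter.eventually_gt_atTop (2 * ((m : ℝ) + 1) ^ 2)] with β hβ
    obtain ⟨hmem, hopt⟩ := hsel β (lt_trans (by positivity) hβ)
    exact (Finset.sum_eq_zero fun i _ =>
      recUtil_star_eq_zero_of_Feq_max (by omega) hβ hmem hopt i).symm
end

section
/- (Theorem 2: Frank–Wolfe linear maximization step) Consider a one-sided recommendation setting with two-sided preferences μ_{ij} ≥ 0 for all i,j ∈ {1,…,n}, exposure weights v with v_1 ≥ … ≥ v_p ≥ 0, and let Φ_1,…,Φ_n : ℝ → ℝ be differentiable, concave and increasing. Define W(P) = ∑_{i=1}^n Φ_i(u_i(P)). Fix P⁰ ∈ 𝒫 and set μ̃_{ij} = Φ_i'(u_i(P⁰)) μ_{ij} + Φ_j'(u_j(P⁰)) μ_{ji}. Then the gradient of W at P⁰ satisfies ⟨P, ∇W(P⁰)⟩ = ∑_{i∈𝒩} ∑_{j∈ℐ} ∑_k μ̃_{ij} v_k P_{ijk} for every ranking tensor P, and any P̃ ∈ 𝒫 such that for every user i, every σ ∈ 𝔖(P̃_i), and all items j, j', σ(j) < σ(j')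 implies μ̃_{ij} ≥ μ̃_{ij'}, satisfies P̃ ∈ argmax_{P∈𝒫} ⟨P, ∇W(P⁰)⟩. -/
/-- Index type for the `n = m + p` entities: users `𝒩` (left) and items `ℐ` (right). -/
abbrev Idx (m p : ℕ) := Fin m ⊕ Fin p

/-- Extension of a ranking tensor with zero entries outside `𝒩 × ℐ`. -/
def Pfull {m p : ℕ} (P : Fin m → Fin p → Fin p → ℝ) :
    Idx m p → Idx m p → Fin p → ℝ :=
  fun x y k =>
    match x, y with
    | Sum.inl i, Sum.inr j => P i j k
    | _, _ => 0

/-- Two-sided utility `u_x(P) = ∑_y μ_{xy} ∑_k (P_{xyk} + P_{yxk}) v_k`. -/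
def util2 {m p : ℕ} (μ : Idx m p → Idx m p → ℝ) (v : Fin p → ℝ)
    (P : Fin m → Fin p → Fin p → ℝ) (x : Idx m p) : ℝ :=
  ∑ y, μ x y * ∑ k, (Pfull P x y k + Pfull P y x k) * v k

/-- `σ ∈ 𝔖(M)` : the permutation `σ` (mapping items to ranks) is in the support of
the stochastic ranking `M`. -/
def InSupport {p : ℕ} (M : Fin p → Fin p → ℝ) (σ : Equiv.Perm (Fin p)) : Prop :=
  ∀ j, 0 < M j (σ j)

/-- The welfare objective `W(P) = ∑_x Φ_x(u_x(P))` as a function of the tensor. -/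
def Wfun {m p : ℕ} (μ : Idx m p → Idx m p → ℝ) (v : Fin p → ℝ)
    (Φ : Idx m p → ℝ → ℝ) (P : Fin m → Fin p → Fin p → ℝ) : ℝ :=
  ∑ x, Φ x (util2 μ v P x)

/-- `μ̃_{ij} = Φ_i'(u_i(P⁰)) μ_{ij} + Φ_j'(u_j(P⁰)) μ_{ji}`. -/
noncomputable def tmu {m p : ℕ} (μ : Idx m p → Idx m p → ℝ) (v : Fin p → ℝ)
    (Φ : Idx m p → ℝ → ℝ) (P0 : Fin m → Fin p → Fin p → ℝ)
    (i : Fin m) (j : Fin p) : ℝ :=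
  deriv (Φ (Sum.inl i)) (util2 μ v P0 (Sum.inl i)) * μ (Sum.inl i) (Sum.inr j) +
    deriv (Φ (Sum.inr j)) (util2 μ v P0 (Sum.inr j)) * μ (Sum.inr j) (Sum.inl i)

theorem util2_inl {m p : ℕ} (μ : Idx m p → Idx m p → ℝ) (v : Fin p → ℝ)
    (P : Fin m → Fin p → Fin p → ℝ) (i : Fin m) :
    util2 μ v P (Sum.inl i) = ∑ j, μ (Sum.inl i) (Sum.inr j) * ∑ k, P i j k * v k := by
  simp [util2, Pfull]

theorem util2_inr {m p : ℕ} (μ : Idx m p → Idx m p → ℝ) (v : Fin p → ℝ)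
    (P : Fin m → Fin p → Fin p → ℝ) (j : Fin p) :
    util2 μ v P (Sum.inr j) = ∑ i, μ (Sum.inr j) (Sum.inl i) * ∑ k, P i j k * v k := by
  simp [util2, Pfull]

theorem isLinearMap_util2 {m p : ℕ} (μ : Idx m p → Idx m p → ℝ) (v : Fin p → ℝ)
    (x : Idx m p) : IsLinearMap ℝ (fun P => util2 μ v P x) := by
  constructor
  · intro P Q
    rcases x with i | j
    · simp only [util2_inl, Pi.add_apply, add_mul, mul_add, Finset.sum_add_distrib]
    · simp only [util2_inr, Pi.add_apply, add_mul, mul_add, Finset.sum_add_distrib]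
  · intro c P
    rcases x with i | j
    · simp only [util2_inl, Pi.smul_apply, smul_eq_mul, mul_assoc, ← Finset.mul_sum,
        mul_left_comm _ c]
    · simp only [util2_inr, Pi.smul_apply, smul_eq_mul, mul_assoc, ← Finset.mul_sum,
        mul_left_comm _ c]

/-- The utility of `x` as a continuous linear functional of the ranking tensor. -/
noncomputable def utilCLM {m p : ℕ} (μ : Idx m p → Idx m p → ℝ) (v : Fin p → ℝ)
    (x : Idx m p) : (Fin m → Fin p → Fin p → ℝ) →L[ℝ] ℝ :=
  LinearMap.toContinuousLinearMap (isLinearMap_util2 μ v x).mk'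

theorem utilCLM_apply {m p : ℕ} (μ : Idx m p → Idx m p → ℝ) (v : Fin p → ℝ)
    (x : Idx m p) (P : Fin m → Fin p → Fin p → ℝ) : utilCLM μ v x P = util2 μ v P x := rfl

theorem hasFDerivAt_Wfun {m p : ℕ} (μ : Idx m p → Idx m p → ℝ) (v : Fin p → ℝ)
    (Φ : Idx m p → ℝ → ℝ) (hdiff : ∀ x, Differentiable ℝ (Φ x))
    (P0 : Fin m → Fin p → Fin p → ℝ) :
    HasFDerivAt (Wfun μ v Φ)
      (∑ x, deriv (Φ x) (util2 μ v P0 x) • utilCLM μ v x) P0 := by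
  refine HasFDerivAt.fun_sum fun x _ => ?_
  exact (hdiff x (util2 μ v P0 x)).hasDerivAt.comp_hasFDerivAt P0
    (utilCLM μ v x).hasFDerivAt

theorem fderiv_Wfun_apply {m p : ℕ} (μ : Idx m p → Idx m p → ℝ) (v : Fin p → ℝ)
    (Φ : Idx m p → ℝ → ℝ) (hdiff : ∀ x, Differentiable ℝ (Φ x))
    (P0 P : Fin m → Fin p → Fin p → ℝ) :
    fderiv ℝ (Wfun μ v Φ) P0 P = ∑ i, ∑ j, ∑ k, tmu μ v Φ P0 i j * v k * P i j k := by
  rw [(hasFDerivAt_Wfun μ v Φ hdiff P0).fderiv]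
  simp only [Fintype.sum_sum_type, add_apply, sum_apply, smul_apply, utilCLM_apply,
    smul_eq_mul]
  simp only [util2_inl μ v P, util2_inr μ v P, Finset.mul_sum]
  rw [Finset.sum_comm (s := (Finset.univ : Finset (Fin p))) (t := (Finset.univ : Finset (Fin m))),
    ← Finset.sum_add_distrib]
  refine Finset.sum_congr rfl fun i _ => ?_
  rw [← Finset.sum_add_distrib]
  refine Finset.sum_congr rfl fun j _ => ?_
  rw [← Finset.sum_add_distrib]
  refine Finset.sum_congr rfl fun k _ => ?_
  rw [tmu]
  ring

/-- Birkhoff decomposition of a doubly stochastic matrix over permutations in its support. -/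
theorem DoublyStochastic.exists_perm_weights {p : ℕ} {M : Fin p → Fin p → ℝ}
    (hM : DoublyStochastic M) :
    ∃ w : Equiv.Perm (Fin p) → ℝ, (∀ σ, 0 ≤ w σ) ∧ ∑ σ, w σ = 1 ∧
      (∀ σ, 0 < w σ → InSupport M σ) ∧
      ∀ t v : Fin p → ℝ, ∑ j, ∑ k, t j * v k * M j k = ∑ σ, w σ * ∑ j, t j * v (σ j) := by
  obtain ⟨w, hw0, hw1, hw⟩ := exists_eq_sum_perm_of_mem_doublyStochastic
    (M := Matrix.of M) (mem_doublyStochastic_iff_sum.2 hM)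
  have hentry (j k : Fin p) : M j k = ∑ σ, w σ * if σ j = k then 1 else 0 := by
    have := congrFun (congrFun hw j) k
    simpa [Matrix.sum_apply, Equiv.Perm.permMatrix, PEquiv.toMatrix_apply, eq_comm] using this.symm
  refine ⟨w, hw0, hw1, fun σ hσ j => ?_, fun t v => ?_⟩
  · rw [hentry]
    refine Finset.sum_pos' (fun τ _ => mul_nonneg (hw0 τ) (by split_ifs <;> norm_num))
      ⟨σ, Finset.mem_univ σ, by simpa using hσ⟩
  · simp only [hentry, Finset.mul_sum]
    rw [Finset.sum_comm (s := (Finset.univ : Finset (Equiv.Perm (Fin p))))]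
    refine Finset.sum_congr rfl fun j _ => ?_
    rw [Finset.sum_comm]
    refine Finset.sum_congr rfl fun σ _ => ?_
    simp [mul_comm]

/-- A stochastic ranking whose support sorts the scores `t` in nonincreasing order maximizes
the expected exposure-weighted score. -/
theorem DoublyStochastic.sum_le_of_support_sorted {p : ℕ} {M N : Fin p → Fin p → ℝ}
    (hM : DoublyStochastic M) (hN : DoublyStochastic N) {t v : Fin p → ℝ} (hv : Antitone v)
    (hsort : ∀ σ, InSupport M σ → ∀ j j' : Fin p, σ j < σ j' → t j' ≤ t j) :
    ∑ j, ∑ k, t j * v k * N j k ≤ ∑ j, ∑ k, t j * v k * M j k := by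
  obtain ⟨w, hw0, hw1, hws, hw⟩ := hM.exists_perm_weights
  obtain ⟨w', hw'0, hw'1, -, hw'⟩ := hN.exists_perm_weights
  rw [hw, hw']
  have key (τ : Equiv.Perm (Fin p)) :
      ∑ j, t j * v (τ j) ≤ ∑ σ, w σ * ∑ j, t j * v (σ j) := by
    rw [← one_mul (∑ j, t j * v (τ j)), ← hw1, Finset.sum_mul]
    refine Finset.sum_le_sum fun σ _ => ?_
    rcases (hw0 σ).eq_or_lt with h | h
    · simp [← h]
    · refine mul_le_mul_of_nonneg_left ?_ h.le
      have hmv : Monovary t (v ∘ σ) := fun j j' hjj' =>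
        hsort σ (hws σ h) j' j (hv.reflect_lt hjj')
      simpa using hmv.sum_mul_comp_perm_le_sum_mul (σ := σ⁻¹ * τ)
  calc _ ≤ ∑ τ, w' τ * ∑ σ, w σ * ∑ j, t j * v (σ j) :=
        Finset.sum_le_sum fun τ _ => mul_le_mul_of_nonneg_left (key τ) (hw'0 τ)
    _ = _ := by rw [← Finset.sum_mul, hw'1, one_mul]

/-- Theorem 2: Frank–Wolfe linear maximization step: the pairing of a
ranking tensor `P` with the gradient of `W` at `P⁰` equals `∑_{ijk} μ̃_{ij} v_k P_{ijk}`,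
and any ranking tensor sorting each user's items by nonincreasing `μ̃_{ij}` maximizes
this pairing over `𝒫`. -/
theorem frank_wolfe_linear_step (m p : ℕ)
    (μ : Idx m p → Idx m p → ℝ) (hμ : ∀ x y, 0 ≤ μ x y)
    (v : Fin p → ℝ) (hv0 : ∀ k, 0 ≤ v k) (hvmono : ∀ k l : Fin p, k ≤ l → v l ≤ v k)
    (Φ : Idx m p → ℝ → ℝ) (hdiff : ∀ x, Differentiable ℝ (Φ x))
    (hconc : ∀ x, ConcaveOn ℝ Set.univ (Φ x)) (hmono : ∀ x, Monotone (Φ x))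
    (P0 : Fin m → Fin p → Fin p → ℝ) (hP0 : P0 ∈ RankingTensors m p) :
    (∀ P ∈ RankingTensors m p,
      fderiv ℝ (Wfun μ v Φ) P0 P = ∑ i, ∑ j, ∑ k, tmu μ v Φ P0 i j * v k * P i j k) ∧
    ∀ Ptil ∈ RankingTensors m p,
      (∀ (i : Fin m) (σ : Equiv.Perm (Fin p)), InSupport (Ptil i) σ →
        ∀ j j' : Fin p, σ j < σ j' → tmu μ v Φ P0 i j' ≤ tmu μ v Φ P0 i j) →
      ∀ P ∈ RankingTensors m p,
        fderiv ℝ (Wfun μ v Φ) P0 P ≤ fderiv ℝ (Wfun μ v Φ) P0 Ptil := by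
  refine ⟨fun P _ => fderiv_Wfun_apply μ v Φ hdiff P0 P, fun Ptil hPtil hsort P hP => ?_⟩
  rw [fderiv_Wfun_apply μ v Φ hdiff, fderiv_Wfun_apply μ v Φ hdiff]
  exact Finset.sum_le_sum fun i _ =>
    (hPtil i).sum_le_of_support_sorted (hP i) (fun k l h => hvmono k l h) (hsort i)
end
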